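/- Let (X,d,T) be a topological dynamical system and μ a T-invariant Borel probability measure. Then (X,T) is μ-F-equicontinuous; that is, for every τ > 0 there exists a compact set M ⊆ X with μ(M) > 1-τ such that for every ε > 0 there is δ > 0 with: x,y ∈ M and d(x,y) < δ imply F(x,y) < ε. -/

import Mathlib

open Filter Metric Set

variable {X : Type*} [MetricSpace X]

/-- The maximal cardinality of an `(n,δ)`-match of `x` and `y`: an order-preserving
bijection `π : D(π) → R(π)` between subsets of `{0,…,n-1}` such that
`d(T^i x, T^{π i} y) < δ` for all `i ∈ D(π)`, encoded by a pair of strictly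
increasing enumerations of `D(π)` and `R(π)`. -/
noncomputable def fkFit (T : X → X) (n : ℕ) (δ : ℝ) (x y : X) : ℕ :=
  sSup {k : ℕ | ∃ i j : Fin k → Fin n, StrictMono i ∧ StrictMono j ∧
    ∀ s, dist (T^[(i s : ℕ)] x) (T^[(j s : ℕ)] y) < δ}

/-- `f̄_{n,δ}(x,y) = 1 - (max match)/n`. -/
noncomputable def fkF (T : X → X) (n : ℕ) (δ : ℝ) (x y : X) : ℝ :=
  1 - (fkFit T n δ x y : ℝ) / n

/-- The Feldman–Katok metric `d_{FK_n}`. -/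
noncomputable def dFKn (T : X → X) (n : ℕ) (x y : X) : ℝ :=
  sInf {δ : ℝ | 0 < δ ∧ fkF T n δ x y < δ}

/-- The Feldman–Katok pseudometric `d_{FK}`. -/
noncomputable def dFK (T : X → X) (x y : X) : ℝ :=
  sInf {δ : ℝ | 0 < δ ∧ Filter.limsup (fun n => fkF T n δ x y) atTop < δ}

/-- The maximal cardinality of an `(n,δ)*`-match of `x` and `y`: a not necessarily
order-preserving bijection `π : D(π) → R(π)` between subsets of `{0,…,n-1}` with
`d(T^i x, T^{π i} y) < δ` on its domain, encoded by a pair of injections. -/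
noncomputable def wFit (T : X → X) (n : ℕ) (δ : ℝ) (x y : X) : ℕ :=
  sSup {k : ℕ | ∃ i j : Fin k → Fin n, Function.Injective i ∧ Function.Injective j ∧
    ∀ s, dist (T^[(i s : ℕ)] x) (T^[(j s : ℕ)] y) < δ}

/-- `f̃_{n,δ}(x,y) = 1 - (max match)/n`. -/
noncomputable def wFbar (T : X → X) (n : ℕ) (δ : ℝ) (x y : X) : ℝ :=
  1 - (wFit T n δ x y : ℝ) / n

/-- The Feldman–Katok pseudometric without the order-preserving requirement. -/
noncomputable def dFKt (T : X → X) (x y : X) : ℝ :=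
  sInf {δ : ℝ | 0 < δ ∧ Filter.limsup (fun n => wFbar T n δ x y) atTop < δ}

/-- `F_n(x,y) = (1/n) inf_{σ ∈ S_n} ∑_{k<n} d(T^k x, T^{σ k} y)`. -/
noncomputable def weakMeanN (T : X → X) (n : ℕ) (x y : X) : ℝ :=
  (1 / n : ℝ) * ⨅ σ : Equiv.Perm (Fin n),
    ∑ k : Fin n, dist (T^[(k : ℕ)] x) (T^[(σ k : ℕ)] y)

/-- The weak-mean pseudometric `F(x,y) = limsup_n F_n(x,y)`. -/
noncomputable def weakMean (T : X → X) (x y : X) : ℝ :=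
  Filter.limsup (fun n => weakMeanN T n x y) Filter.atTop

open MeasureTheory
set_option linter.unusedSectionVars false

/-- partial maxima of Birkhoff sums -/
noncomputable def bkMax (T : X → X) (g : X → ℝ) : ℕ → X → ℝ
  | 0 => fun _ => 0
  | n + 1 => fun x => max 0 (g x + bkMax T g n (T x))

lemma bkMax_nonneg (T : X → X) (g : X → ℝ) (n : ℕ) (x : X) : 0 ≤ bkMax T g n x := by
  cases n with
  | zero => simp [bkMax]
  | succ n => exact le_max_left _ _

lemma bkMax_mono (T : X → X) (g : X → ℝ) (n : ℕ) (x : X) :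
    bkMax T g n x ≤ bkMax T g (n+1) x := by
  induction n generalizing x with
  | zero => exact le_max_left _ _
  | succ n ih =>
    have := ih (T x)
    simp only [bkMax] at this ⊢
    gcongr

lemma bkMax_le (T : X → X) (g : X → ℝ) (C : ℝ) (hC : 0 ≤ C) (hg : ∀ x, |g x| ≤ C) (n : ℕ) (x : X) :
    bkMax T g n x ≤ n * C := by
  induction n generalizing x with
  | zero => simp [bkMax]
  | succ n ih =>
    have h1 := ih (T x)
    have h2 := (abs_le.1 (hg x)).2
    simp only [bkMax]
    push_cast
    apply max_le
    · positivity
    · linarith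

lemma birkhoffSum_le_bkMax (T : X → X) (g : X → ℝ) (n : ℕ) (x : X) :
    birkhoffSum T g n x ≤ bkMax T g n x := by
  induction n generalizing x with
  | zero => simp [bkMax]
  | succ n ih =>
    rw [birkhoffSum_succ']
    exact le_trans (by linarith [ih (T x)]) (le_max_right _ _)

lemma bkMax_measurable [MeasurableSpace X] (T : X → X) (hT : Measurable T) (g : X → ℝ)
    (hg : Measurable g) (n : ℕ) : Measurable (bkMax T g n) := by
  induction n with
  | zero => exact measurable_const
  | succ n ih => exact measurable_const.max (hg.add (ih.comp hT))

lemma max_ergodic [MeasurableSpace X] (T : X → X) (μ : Measure X) [IsProbabilityMeasure μ]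
    (hμ : MeasurePreserving T μ μ) (g : X → ℝ) (hg : Measurable g) (C : ℝ)
    (hC : ∀ x, |g x| ≤ C) (hpos : ∀ x, g x ≠ 0 → ∃ n, 0 < birkhoffSum T g n x) :
    0 ≤ ∫ x, g x ∂μ := by
  have hX : Nonempty X := by
    by_contra h
    rw [not_nonempty_iff] at h
    exact IsProbabilityMeasure.ne_zero μ (Measure.eq_zero_of_isEmpty μ)
  have hC0 : 0 ≤ C := (abs_nonneg _).trans (hC hX.some)
  have hmG := bkMax_measurable T hμ.measurable g hg
  have hS : ∀ n, MeasurableSet {x | 0 < bkMax T g n x} := fun n =>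
    measurableSet_lt measurable_const (hmG n)
  have hInt : ∀ n, Integrable (bkMax T g n) μ := fun n =>
    Integrable.of_bound (hmG n).aestronglyMeasurable (n * C) (Eventually.of_forall fun x => by
      rw [Real.norm_eq_abs, abs_of_nonneg (bkMax_nonneg T g n x)]
      exact bkMax_le T g C hC0 hC n x)
  have hgi : Integrable g μ :=
    Integrable.of_bound hg.aestronglyMeasurable C (Eventually.of_forall hC)
  have key : ∀ n, 0 ≤ ∫ x, {x | 0 < bkMax T g n x}.indicator g x ∂μ := by
    intro n
    have h1 : ∫ x, bkMax T g n (T x) ∂μ = ∫ x, bkMax T g n x ∂μ := by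
      have := integral_map (μ := μ) (φ := T) hμ.measurable.aemeasurable
        (f := bkMax T g n) (hmG n).aestronglyMeasurable
      rw [hμ.map_eq] at this
      exact this.symm
    have hIntT : Integrable (fun x => bkMax T g n (T x)) μ :=
      hμ.integrable_comp_of_integrable (hInt n)
    have h2 : ∫ x, (bkMax T g n x - bkMax T g n (T x)) ∂μ ≤
        ∫ x, {x | 0 < bkMax T g n x}.indicator g x ∂μ := by
      apply integral_mono ((hInt n).sub hIntT) (hgi.indicator (hS n))
      intro x
      by_cases hx : 0 < bkMax T g n x
      · simp only [indicator, mem_ofPred_eq, hx, if_true]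
        cases n with
        | zero => simp [bkMax] at hx
        | succ n =>
          have h3 := bkMax_mono T g n (T x)
          have h4 : bkMax T g (n+1) x = g x + bkMax T g n (T x) := by
            simp only [bkMax] at hx ⊢
            rcases max_cases 0 (g x + bkMax T g n (T x)) with h | h
            · rw [h.1] at hx; exact absurd hx (lt_irrefl _)
            · exact h.1
          change bkMax T g (n+1) x - bkMax T g (n+1) (T x) ≤ g x
          linarith
      · simp only [indicator, mem_ofPred_eq, hx, if_false]
        have := bkMax_nonneg T g n (T x)
        change bkMax T g n x - bkMax T g n (T x) ≤ 0
        linarith [not_lt.1 hx]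
    rw [integral_sub (hInt n) hIntT, h1, sub_self] at h2
    exact h2
  have hlim : Tendsto (fun n => ∫ x, {x | 0 < bkMax T g n x}.indicator g x ∂μ) atTop
      (nhds (∫ x, g x ∂μ)) := by
    apply tendsto_integral_of_dominated_convergence (fun _ => C)
    · exact fun n => (hg.indicator (hS n)).aestronglyMeasurable
    · exact integrable_const C
    · intro n
      refine Eventually.of_forall fun x => ?_
      exact (norm_indicator_le_norm_self g x).trans (hC x)
    · refine Eventually.of_forall fun x => ?_
      apply tendsto_const_nhds.congr'
      by_cases hx : g x = 0
      · refine Eventually.of_forall fun n => ?_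
        simp [indicator, hx]
      · obtain ⟨n, hn⟩ := hpos x hx
        filter_upwards [eventually_ge_atTop n] with m hm
        have hmono : Monotone (fun n => bkMax T g n x) :=
          monotone_nat_of_le_succ fun n => bkMax_mono T g n x
        have h5 : 0 < bkMax T g m x :=
          hn.trans_le ((birkhoffSum_le_bkMax T g n x).trans (hmono hm))
        simp [indicator, h5]
  exact ge_of_tendsto' hlim key

/-- points where the Birkhoff sums of `h` are unbounded above -/
def bkUnb (T : X → X) (h : X → ℝ) : Set X := {x | ∀ K : ℕ, ∃ n, (K : ℝ) < birkhoffSum T h n x}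

lemma bkUnb_inv (T : X → X) (h : X → ℝ) (x : X) : T x ∈ bkUnb T h ↔ x ∈ bkUnb T h := by
  constructor
  · intro hx K
    obtain ⟨L, hL⟩ := exists_nat_gt (K - h x)
    obtain ⟨n, hn⟩ := hx L
    exact ⟨n+1, by rw [birkhoffSum_succ']; linarith⟩
  · intro hx K
    obtain ⟨L, hL⟩ := exists_nat_gt (K + |h x|)
    obtain ⟨n, hn⟩ := hx L
    have h0 : (0:ℝ) ≤ K := Nat.cast_nonneg K
    cases n with
    | zero => simp at hn; linarith [abs_nonneg (h x)]
    | succ n =>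
      rw [birkhoffSum_succ'] at hn
      exact ⟨n, by linarith [le_abs_self (h x)]⟩

lemma birkhoffSum_measurable' [MeasurableSpace X] (T : X → X) (hT : Measurable T) (h : X → ℝ)
    (hh : Measurable h) (n : ℕ) : Measurable (birkhoffSum T h n) := by
  unfold birkhoffSum
  exact Finset.measurable_sum _ fun i _ => hh.comp (hT.iterate i)

lemma bkUnb_measurable [MeasurableSpace X] (T : X → X) (hT : Measurable T) (h : X → ℝ)
    (hh : Measurable h) : MeasurableSet (bkUnb T h) := by
  have : bkUnb T h = ⋂ K : ℕ, ⋃ n, {x | (K:ℝ) < birkhoffSum T h n x} := by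
    ext x; simp [bkUnb]
  rw [this]
  exact MeasurableSet.iInter fun K => MeasurableSet.iUnion fun n =>
    measurableSet_lt measurable_const (birkhoffSum_measurable' T hT h hh n)

lemma integral_bkUnb [MeasurableSpace X] (T : X → X) (μ : Measure X) [IsProbabilityMeasure μ]
    (hμ : MeasurePreserving T μ μ) (h : X → ℝ) (hh : Measurable h) (C : ℝ)
    (hC : ∀ x, |h x| ≤ C) (E : Set X) (hE : MeasurableSet E) (hinv : ∀ x, T x ∈ E ↔ x ∈ E)
    (hsub : E ⊆ bkUnb T h) : 0 ≤ ∫ x in E, h x ∂μ := by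
  rw [← integral_indicator hE]
  apply max_ergodic T μ hμ _ (hh.indicator hE) C
  · intro x
    exact (norm_indicator_le_norm_self h x).trans (hC x)
  · intro x hx
    have hxE : x ∈ E := mem_of_indicator_ne_zero hx
    obtain ⟨n, hn⟩ := hsub hxE 0
    refine ⟨n, ?_⟩
    have hit : ∀ k, T^[k] x ∈ E := by
      intro k
      induction k with
      | zero => exact hxE
      | succ k ih => rw [Function.iterate_succ_apply']; exact (hinv _).2 ih
    have : birkhoffSum T (E.indicator h) n x = birkhoffSum T h n x := by
      unfold birkhoffSum
      exact Finset.sum_congr rfl fun k _ => indicator_of_mem (hit k) h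
    rw [this]
    simpa using hn

lemma birkhoff_ae [MeasurableSpace X] (T : X → X) (μ : Measure X) [IsProbabilityMeasure μ]
    (hμ : MeasurePreserving T μ μ) (f : X → ℝ) (hf : Measurable f)
    (hf0 : ∀ x, |f x| ≤ 1) :
    ∀ᵐ x ∂μ, ∃ c, Tendsto (fun n : ℕ => birkhoffSum T f n x / n) atTop (nhds c) := by
  have hsum : ∀ (c : ℝ) n x, birkhoffSum T (fun x => f x - c) n x = birkhoffSum T f n x - n * c := by
    intro c n x
    simp [birkhoffSum, Finset.sum_sub_distrib]
  have hsum' : ∀ (c : ℝ) n x, birkhoffSum T (fun x => c - f x) n x = n * c - birkhoffSum T f n x := by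
    intro c n x
    simp [birkhoffSum, Finset.sum_sub_distrib]
  have hnull : ∀ a b : ℚ, a < b →
      ∀ᵐ x ∂μ, ¬ (x ∈ bkUnb T (fun x => (a:ℝ) - f x) ∧ x ∈ bkUnb T (fun x => f x - (b:ℝ))) := by
    intro a b hab
    set E := bkUnb T (fun x => (a:ℝ) - f x) ∩ bkUnb T (fun x => f x - (b:ℝ)) with hEdef
    have hE : MeasurableSet E :=
      (bkUnb_measurable T hμ.measurable _ (hf.const_sub _)).inter
        (bkUnb_measurable T hμ.measurable _ (hf.sub_const _))
    have hinv : ∀ x, T x ∈ E ↔ x ∈ E := fun x => and_congr (bkUnb_inv _ _ x) (bkUnb_inv _ _ x)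
    have h1 := integral_bkUnb T μ hμ (fun x => (a:ℝ) - f x) (hf.const_sub _) (|(a:ℝ)| + 1)
      (fun x => (abs_sub _ _).trans (by linarith [hf0 x])) E hE hinv inter_subset_left
    have h2 := integral_bkUnb T μ hμ (fun x => f x - (b:ℝ)) (hf.sub_const _) (1 + |(b:ℝ)|)
      (fun x => (abs_sub _ _).trans (by linarith [hf0 x])) E hE hinv inter_subset_right
    have hfi : Integrable f (μ.restrict E) :=
      Integrable.of_bound hf.aestronglyMeasurable 1 (Eventually.of_forall hf0)
    rw [integral_sub (integrable_const _) hfi] at h1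
    rw [integral_sub hfi (integrable_const _)] at h2
    simp only [integral_const, smul_eq_mul] at h1 h2
    have hab' : (a:ℝ) < b := by exact_mod_cast hab
    have h3 : (μ.restrict E).real univ = 0 := by
      have h4 : 0 ≤ (μ.restrict E).real univ := measureReal_nonneg
      nlinarith
    have h5 : μ E = 0 := by
      rw [measureReal_restrict_apply_univ] at h3
      exact (measureReal_eq_zero_iff).1 h3
    rw [ae_iff]
    have h6 : {x | ¬¬(x ∈ bkUnb T (fun x => (a:ℝ) - f x) ∧ x ∈ bkUnb T (fun x => f x - (b:ℝ)))} = E := by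
      ext x; exact not_not
    rw [h6]; exact h5
  have hall : ∀ᵐ x ∂μ, ∀ a b : ℚ, a < b →
      ¬ (x ∈ bkUnb T (fun x => (a:ℝ) - f x) ∧ x ∈ bkUnb T (fun x => f x - (b:ℝ))) := by
    rw [ae_all_iff]; intro a
    rw [ae_all_iff]; intro b
    by_cases hab : a < b
    · filter_upwards [hnull a b hab] with x hx _ using hx
    · exact Eventually.of_forall fun x h => absurd h hab
  filter_upwards [hall] with x hx
  have hbd : ∀ n : ℕ, |birkhoffSum T f n x / n| ≤ 1 := by
    intro n
    rw [abs_div, Nat.abs_cast]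
    apply div_le_one_of_le₀ _ (Nat.cast_nonneg n)
    calc |birkhoffSum T f n x| ≤ ∑ k ∈ Finset.range n, |f (T^[k] x)| := Finset.abs_sum_le_sum_abs _ _
      _ ≤ ∑ k ∈ Finset.range n, 1 := Finset.sum_le_sum fun k _ => hf0 _
      _ = n := by simp
  refine tendsto_of_no_upcrossings (s := univ) dense_univ ?_ ?_ ?_
  · rintro a - b - hab ⟨ha, hb⟩
    obtain ⟨a', haa', ha'b⟩ := exists_rat_btwn hab
    obtain ⟨b', hab', hb'b⟩ := exists_rat_btwn ha'b
    refine hx a' b' (by exact_mod_cast hab') ⟨fun K => ?_, fun K => ?_⟩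
    · obtain ⟨N, hN⟩ := exists_nat_gt (K / (a' - a))
      obtain ⟨n, hn, hnN⟩ := (ha.and_eventually (eventually_ge_atTop (N+1))).exists
      refine ⟨n, ?_⟩
      rw [hsum']
      have hn0 : (0:ℝ) < n := by exact_mod_cast (by omega : 0 < n)
      have hnN' : (N:ℝ) ≤ n := by exact_mod_cast (by omega : N ≤ n)
      rw [div_lt_iff₀ hn0] at hn
      rw [div_lt_iff₀ (by linarith)] at hN
      nlinarith
    · obtain ⟨N, hN⟩ := exists_nat_gt (K / (b - b'))
      obtain ⟨n, hn, hnN⟩ := (hb.and_eventually (eventually_ge_atTop (N+1))).exists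
      refine ⟨n, ?_⟩
      rw [hsum]
      have hn0 : (0:ℝ) < n := by exact_mod_cast (by omega : 0 < n)
      have hnN' : (N:ℝ) ≤ n := by exact_mod_cast (by omega : N ≤ n)
      rw [lt_div_iff₀ hn0] at hn
      rw [div_lt_iff₀ (by linarith)] at hN
      nlinarith
  · exact isBoundedUnder_of ⟨1, fun n => (abs_le.1 (hbd n)).2⟩
  · exact isBoundedUnder_of ⟨-1, fun n => (abs_le.1 (hbd n)).1⟩

lemma exists_perm_match {n K : ℕ} (p q : Fin n → ℕ) (hp : ∀ k, p k < K) (t : ℝ) (ht : 0 ≤ t)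
    (h : ∀ j < K, ((Finset.univ.filter fun k => p k = j).card : ℝ) -
      (Finset.univ.filter fun k => q k = j).card ≤ t) :
    ∃ σ : Equiv.Perm (Fin n),
      ((Finset.univ.filter fun k => p k ≠ q (σ k)).card : ℝ) ≤ K * t := by
  classical
  obtain ⟨σ, hσ⟩ := Finite.exists_min
    (fun σ : Equiv.Perm (Fin n) => (Finset.univ.filter fun k => p k ≠ q (σ k)).card)
  refine ⟨σ, ?_⟩
  have hcl : ∀ j < K,
      ((Finset.univ.filter fun k => p k ≠ q (σ k) ∧ p k = j).card : ℝ) ≤ t := by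
    intro j hj
    rcases (Finset.univ.filter fun k => p k ≠ q (σ k) ∧ p k = j).eq_empty_or_nonempty with h0 | ⟨k, hk⟩
    · rw [h0]; simpa using ht
    · simp only [Finset.mem_filter, Finset.mem_univ, true_and] at hk
      have hno : ∀ k', q (σ k') = j → p k' = j := by
        intro k' hk'
        by_contra hne
        have hkk : k ≠ k' := by rintro rfl; exact hne hk.2
        have hlt : (Finset.univ.filter fun i => p i ≠ q (((Equiv.swap k k').trans σ) i)).card <
            (Finset.univ.filter fun k => p k ≠ q (σ k)).card := by
          apply Finset.card_lt_card
          rw [Finset.ssubset_iff_of_subset]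
          · refine ⟨k, by simpa using hk.1, ?_⟩
            intro hmem
            have h7 := (Finset.mem_filter.1 hmem).2
            rw [Equiv.trans_apply, Equiv.swap_apply_left] at h7
            exact h7 (hk.2.trans hk'.symm)
          · intro i hi
            replace hi := (Finset.mem_filter.1 hi).2
            rw [Equiv.trans_apply] at hi
            refine Finset.mem_filter.2 ⟨Finset.mem_univ _, ?_⟩
            by_cases hik : i = k
            · rw [hik]; exact hk.1
            · by_cases hik' : i = k'
              · rw [hik', hk']; exact hne
              · rwa [Equiv.swap_apply_of_ne_of_ne hik hik'] at hi
        exact absurd (hσ ((Equiv.swap k k').trans σ)) (not_le.2 hlt)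
      have h1 : (Finset.univ.filter fun k => q k = j).card =
          (Finset.univ.filter fun k => q (σ k) = j).card := by
        symm
        apply Finset.card_bij (fun k _ => σ k)
        · intro a ha; simpa using ha
        · intro a _ b _ hab; exact σ.injective hab
        · intro b hb; exact ⟨σ.symm b, by simpa using hb, by simp⟩
      have h2 : (Finset.univ.filter fun k => p k = j).card =
          (Finset.univ.filter fun k => p k ≠ q (σ k) ∧ p k = j).card +
          (Finset.univ.filter fun k => q (σ k) = j).card := by
        rw [← Finset.card_union_of_disjoint]
        · congr 1
          ext i
          simp only [Finset.mem_filter, Finset.mem_univ, true_and, Finset.mem_union]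
          constructor
          · intro hi
            by_cases hq : q (σ i) = j
            · exact Or.inr hq
            · exact Or.inl ⟨by rw [hi]; exact Ne.symm hq, hi⟩
          · rintro (hi | hi)
            · exact hi.2
            · exact hno i hi
        · rw [Finset.disjoint_left]
          intro i hi hi'
          simp only [Finset.mem_filter, Finset.mem_univ, true_and] at hi hi'
          exact hi.1 (hi.2.trans hi'.symm)
      have h3 := h j hj
      rw [h1, h2] at h3
      push_cast at h3
      linarith
  have hsum : (Finset.univ.filter fun k => p k ≠ q (σ k)).card =
      ∑ j ∈ Finset.range K, (Finset.univ.filter fun k => p k ≠ q (σ k) ∧ p k = j).card := by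
    rw [Finset.card_eq_sum_card_fiberwise (f := p) (t := Finset.range K)]
    · simp only [Finset.filter_filter]
    · intro k _; simpa using hp k
  rw [hsum]
  push_cast
  calc _ ≤ ∑ j ∈ Finset.range K, t := Finset.sum_le_sum fun j hj => hcl j (Finset.mem_range.1 hj)
    _ = K * t := by simp

lemma weakMeanN_nonneg (T : X → X) (n : ℕ) (x y : X) : 0 ≤ weakMeanN T n x y := by
  unfold weakMeanN
  apply mul_nonneg (by positivity)
  exact Real.iInf_nonneg fun σ => Finset.sum_nonneg fun k _ => dist_nonneg

lemma weakMeanN_le (T : X → X) (n : ℕ) (x y : X) (φ : X → ℕ) (K : ℕ) (hφ : ∀ x, φ x < K)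
    (D e t : ℝ) (hD : ∀ x y : X, dist x y ≤ D) (hD0 : 0 ≤ D) (he : ∀ x y, φ x = φ y → dist x y ≤ e)
    (he0 : 0 ≤ e) (ht : 0 ≤ t) (hn : 0 < n)
    (h : ∀ j < K, birkhoffSum T (fun z => if φ z = j then (1:ℝ) else 0) n x / n -
      birkhoffSum T (fun z => if φ z = j then (1:ℝ) else 0) n y / n ≤ t) :
    weakMeanN T n x y ≤ e + K * t * D := by
  have hn' : (0:ℝ) < n := by exact_mod_cast hn
  have hb : ∀ j z, birkhoffSum T (fun z => if φ z = j then (1:ℝ) else 0) n z =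
      ((Finset.univ.filter fun k : Fin n => φ (T^[(k:ℕ)] z) = j).card : ℝ) := by
    intro j z
    rw [birkhoffSum, Finset.sum_range (fun k => if φ (T^[k] z) = j then (1:ℝ) else 0),
      Finset.sum_boole]
  obtain ⟨σ, hσ⟩ := exists_perm_match (K := K) (fun k : Fin n => φ (T^[(k:ℕ)] x))
    (fun k : Fin n => φ (T^[(k:ℕ)] y)) (fun k => hφ _) (n * t) (by positivity) (by
      intro j hj
      have := h j hj
      rw [hb, hb, ← sub_div, div_le_iff₀ hn'] at this
      linarith)
  unfold weakMeanN
  have h1 : (⨅ σ : Equiv.Perm (Fin n), ∑ k : Fin n, dist (T^[(k : ℕ)] x) (T^[(σ k : ℕ)] y)) ≤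
      n * e + K * (n * t) * D := by
    refine (ciInf_le (Set.finite_range _).bddBelow σ).trans ?_
    calc ∑ k : Fin n, dist (T^[(k : ℕ)] x) (T^[(σ k : ℕ)] y)
        ≤ ∑ k : Fin n, (e + if φ (T^[(k:ℕ)] x) ≠ φ (T^[(σ k:ℕ)] y) then D else 0) := by
          apply Finset.sum_le_sum
          intro k _
          split_ifs with hk
          · linarith [hD (T^[(k : ℕ)] x) (T^[(σ k : ℕ)] y)]
          · linarith [he _ _ (not_not.1 hk)]
      _ = n * e + (Finset.univ.filter fun k : Fin n =>
            φ (T^[(k:ℕ)] x) ≠ φ (T^[(σ k:ℕ)] y)).card * D := by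
          rw [Finset.sum_add_distrib, ← Finset.sum_filter]
          simp
      _ ≤ _ := by gcongr
  calc _ ≤ (1 / n : ℝ) * (n * e + K * (n * t) * D) := by gcongr
    _ = _ := by field_simp

lemma exists_label [MeasurableSpace X] [BorelSpace X] [CompactSpace X] [Nonempty X]
    (e : ℝ) (he : 0 < e) : ∃ (K : ℕ) (φ : X → ℕ), Measurable φ ∧ (∀ x, φ x < K) ∧
      ∀ x y, φ x = φ y → dist x y ≤ e := by
  let d := TopologicalSpace.denseSeq X
  have hcov : (univ : Set X) ⊆ ⋃ i, ball (d i) (e/2) := by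
    intro x _
    obtain ⟨i, hi⟩ := (TopologicalSpace.denseRange_denseSeq X).exists_dist_lt x (half_pos he)
    exact mem_iUnion.2 ⟨i, hi⟩
  obtain ⟨s, hs⟩ := isCompact_univ.elim_finite_subcover _ (fun i => isOpen_ball) hcov
  let N := s.sup id
  refine ⟨N + 1, SimpleFunc.nearestPtInd d N, (SimpleFunc.nearestPtInd d N).measurable,
    fun x => Nat.lt_succ_of_le (SimpleFunc.nearestPtInd_le d N x), ?_⟩
  have hnear : ∀ x, dist (d (SimpleFunc.nearestPtInd d N x)) x ≤ e/2 := by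
    intro x
    obtain ⟨i, hi, hx⟩ := mem_iUnion₂.1 (hs (mem_univ x))
    have h1 := SimpleFunc.edist_nearestPt_le d x (k := i) (N := N) (Finset.le_sup (f := id) hi)
    have h2 : dist (d (SimpleFunc.nearestPtInd d N x)) x ≤ dist (d i) x := by
      rw [edist_dist, edist_dist, ENNReal.ofReal_le_ofReal_iff dist_nonneg] at h1
      exact h1
    rw [mem_ball, dist_comm] at hx
    linarith
  intro x y hxy
  have h1 := hnear x
  have h2 := hnear y
  rw [← hxy] at h2
  linarith [dist_triangle_left x y (d (SimpleFunc.nearestPtInd d N x))]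

lemma lusin_aux [MeasurableSpace X] [BorelSpace X] {Y : Type*} [TopologicalSpace Y]
    [SecondCountableTopology Y] [MeasurableSpace Y] [OpensMeasurableSpace Y] (μ : Measure X)
    [IsFiniteMeasure μ] (f : X → Y) (hf : Measurable f) (ε : ENNReal) (hε : ε ≠ 0) :
    ∃ M : Set X, IsClosed M ∧ μ Mᶜ < ε ∧ ContinuousOn f M := by
  let B := TopologicalSpace.countableBasis Y
  have hB := TopologicalSpace.isBasis_countableBasis Y
  have : Countable B := (TopologicalSpace.countable_countableBasis Y).to_subtype
  obtain ⟨r, hr, hrs⟩ := ENNReal.exists_pos_sum_of_countable' hε B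
  have hr2 : ∀ i, r i / 2 ≠ 0 := fun i => (ENNReal.half_pos (hr i).ne').ne'
  have hm : ∀ U : B, MeasurableSet (f ⁻¹' (U : Set Y)) := fun U =>
    hf (hB.isOpen U.2).measurableSet
  choose F hF hFc hFm using fun U : B => (hm U).exists_isClosed_sdiff_lt (measure_ne_top μ _) (hr2 U)
  choose L hL hLc hLm using
    fun U : B => (hm U).compl.exists_isClosed_sdiff_lt (measure_ne_top μ _) (hr2 U)
  refine ⟨⋂ U : B, (F U ∪ L U), isClosed_iInter fun U => (hFc U).union (hLc U), ?_, ?_⟩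
  · rw [compl_iInter]
    refine (measure_iUnion_le _).trans_lt (lt_of_le_of_lt (ENNReal.tsum_le_tsum fun U => ?_) hrs)
    calc μ (F U ∪ L U)ᶜ ≤ μ ((f ⁻¹' (U : Set Y) \ F U) ∪ ((f ⁻¹' (U : Set Y))ᶜ \ L U)) := by
          apply measure_mono
          intro x hx
          simp only [mem_compl_iff, mem_union, not_or] at hx
          by_cases hxU : x ∈ f ⁻¹' (U : Set Y)
          · exact Or.inl ⟨hxU, hx.1⟩
          · exact Or.inr ⟨hxU, hx.2⟩
      _ ≤ r U / 2 + r U / 2 := (measure_union_le _ _).trans (add_le_add (hFm U).le (hLm U).le)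
      _ = r U := ENNReal.add_halves _
  · intro x hx
    rw [ContinuousWithinAt, (hB.nhds_hasBasis).tendsto_right_iff]
    rintro U ⟨hUB, hxU⟩
    have hxL : x ∈ (L ⟨U, hUB⟩)ᶜ := fun h => hL ⟨U, hUB⟩ h hxU
    filter_upwards [self_mem_nhdsWithin,
      mem_nhdsWithin_of_mem_nhds ((hLc ⟨U, hUB⟩).isOpen_compl.mem_nhds hxL)] with y hyM hyL
    rcases mem_iInter.1 hyM ⟨U, hUB⟩ with h | h
    · exact hF _ h
    · exact absurd h hyL

/-- Every topological dynamical system with an invariant Borel probability measure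
`μ` is `μ`-`F`-equicontinuous: for every `τ > 0` there is a compact set `M` with
`μ(M) > 1 - τ`, such that for every `ε > 0` there is `δ > 0` with
`x, y ∈ M`, `d(x,y) < δ` implying `F(x,y) < ε`. -/
theorem mu_F_equicontinuous [MeasurableSpace X] [BorelSpace X] [CompactSpace X]
    (T : X → X) (hT : Continuous T) (μ : Measure X) [IsProbabilityMeasure μ]
    (hμ : MeasurePreserving T μ μ) :
    ∀ τ : ℝ, 0 < τ → ∃ M : Set X, IsCompact M ∧ 1 - ENNReal.ofReal τ < μ M ∧
      ∀ ε : ℝ, 0 < ε → ∃ δ : ℝ, 0 < δ ∧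
        ∀ x ∈ M, ∀ y ∈ M, dist x y < δ → weakMean T x y < ε := by
  intro τ hτ
  have hX : Nonempty X := by
    by_contra h
    rw [not_nonempty_iff] at h
    exact IsProbabilityMeasure.ne_zero μ (Measure.eq_zero_of_isEmpty μ)
  choose K φ hφm hφK hφd using fun m : ℕ =>
    exists_label (X := X) (1 / ((m:ℝ) + 1)) (by positivity)
  let f : ℕ × ℕ → X → ℝ := fun i z => if φ i.1 z = i.2 then (1:ℝ) else 0
  have hfm : ∀ i, Measurable (f i) := fun i =>
    Measurable.ite (hφm i.1 (measurableSet_singleton i.2)) measurable_const measurable_const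
  have hf1 : ∀ i x, |f i x| ≤ 1 := by
    intro i x
    simp only [f]
    split_ifs <;> simp
  let G : X → ℕ × ℕ → ℝ := fun x i => limsup (fun n : ℕ => birkhoffSum T (f i) n x / n) atTop
  have hG : Measurable G := by
    rw [measurable_pi_iff]
    intro i
    exact Measurable.limsup fun n =>
      (birkhoffSum_measurable' T hμ.measurable (f i) (hfm i) n).div_const _
  have hconv : ∀ᵐ x ∂μ, ∀ i, Tendsto (fun n : ℕ => birkhoffSum T (f i) n x / n) atTop
      (nhds (G x i)) := by
    rw [ae_all_iff]
    intro i
    filter_upwards [birkhoff_ae T μ hμ (f i) (hfm i) (hf1 i)] with x ⟨c, hc⟩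
    have : G x i = c := hc.limsup_eq
    rw [this]; exact hc
  obtain ⟨θ, hθ0, hθτ, hθ1⟩ : ∃ θ : ENNReal, 0 < θ ∧ θ ≤ ENNReal.ofReal τ ∧ θ ≤ 1 :=
    ⟨min (ENNReal.ofReal τ) 1, lt_min (by simpa using hτ) one_pos, min_le_left _ _, min_le_right _ _⟩
  have hτ' : θ / 2 ≠ 0 := (ENNReal.half_pos hθ0.ne').ne'
  obtain ⟨M₁, hM₁c, hM₁m, hM₁G⟩ := lusin_aux μ G hG _ hτ'
  obtain ⟨S, hSsub, hSm, hS0⟩ := exists_measurable_superset_of_null (ae_iff.1 hconv)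
  obtain ⟨M₂, hM₂S, hM₂c, hM₂m⟩ :=
    hSm.compl.exists_isClosed_sdiff_lt (measure_ne_top μ _) hτ'
  have hM₂m' : μ M₂ᶜ < θ / 2 := by
    refine lt_of_le_of_lt ?_ hM₂m
    calc μ M₂ᶜ ≤ μ (S ∪ (Sᶜ \ M₂)) := by
          apply measure_mono
          intro x hx
          by_cases hxS : x ∈ S
          · exact Or.inl hxS
          · exact Or.inr ⟨hxS, hx⟩
      _ ≤ μ S + μ (Sᶜ \ M₂) := measure_union_le _ _
      _ = _ := by rw [hS0, zero_add]
  have hMc : IsCompact (M₁ ∩ M₂) := (hM₁c.inter hM₂c).isCompact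
  refine ⟨M₁ ∩ M₂, hMc, ?_, ?_⟩
  · have h1 : μ (M₁ ∩ M₂)ᶜ < θ := by
      rw [compl_inter]
      calc _ ≤ μ M₁ᶜ + μ M₂ᶜ := measure_union_le _ _
        _ < θ / 2 + θ / 2 := ENNReal.add_lt_add hM₁m hM₂m'
        _ = _ := ENNReal.add_halves _
    have h2 : μ (M₁ ∩ M₂) + μ (M₁ ∩ M₂)ᶜ = 1 := by
      rw [measure_add_measure_compl hMc.measurableSet, measure_univ]
    have h4 : μ (M₁ ∩ M₂)ᶜ < θ := h1
    refine lt_of_le_of_lt (tsub_le_tsub_left hθτ 1) ?_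
    apply ENNReal.sub_lt_of_lt_add hθ1
    calc (1 : ENNReal) = μ (M₁ ∩ M₂) + μ (M₁ ∩ M₂)ᶜ := h2.symm
      _ < μ (M₁ ∩ M₂) + θ := ENNReal.add_lt_add_left (measure_ne_top μ _) h4
  intro ε hε
  obtain ⟨m, hm⟩ := exists_nat_one_div_lt (show (0:ℝ) < ε / 4 by linarith)
  obtain ⟨D, hD⟩ : ∃ D : ℝ, ∀ x y : X, dist x y ≤ D :=
    ⟨Metric.diam (univ : Set X), fun x y =>
      Metric.dist_le_diam_of_mem isCompact_univ.isBounded (mem_univ x) (mem_univ y)⟩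
  have hD0 : 0 ≤ D := dist_nonneg.trans (hD hX.some hX.some)
  set η : ℝ := ε / (12 * (K m + 1) * (D + 1)) with hη
  have hη0 : 0 < η := by positivity
  have hcont : ContinuousOn (fun x (j : Fin (K m)) => G x (m, j)) (M₁ ∩ M₂) := by
    have h1 := hM₁G.mono (inter_subset_left (t := M₂))
    exact continuousOn_pi.2 fun j => (continuousOn_pi.1 h1) (m, j)
  obtain ⟨δ, hδ, hδG⟩ := Metric.uniformContinuousOn_iff.1
    (hMc.uniformContinuousOn_of_continuous hcont) η hη0
  refine ⟨δ, hδ, fun x hx y hy hxy => ?_⟩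
  have hxyG : ∀ j < K m, |G x (m, j) - G y (m, j)| < η := by
    intro j hj
    have := (dist_pi_lt_iff hη0).1 (hδG x hx y hy hxy) ⟨j, hj⟩
    simpa [Real.dist_eq] using this
  have hcv : ∀ z ∈ M₁ ∩ M₂, ∀ i, Tendsto (fun n : ℕ => birkhoffSum T (f i) n z / n) atTop
      (nhds (G z i)) := by
    intro z hz
    by_contra hcon
    exact hM₂S hz.2 (hSsub hcon)
  have hev : ∀ z ∈ M₁ ∩ M₂, ∀ᶠ n : ℕ in atTop, ∀ j ∈ Finset.range (K m),
      |birkhoffSum T (f (m, j)) n z / n - G z (m, j)| < η := by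
    intro z hz
    rw [Filter.eventually_all_finset]
    intro j _
    have := (Metric.tendsto_nhds.1 (hcv z hz (m, j))) η hη0
    simpa [Real.dist_eq] using this
  have hfin : weakMean T x y ≤ ε / 2 := by
    unfold weakMean
    apply limsup_le_of_le
    · exact isCoboundedUnder_le_of_le atTop (x := 0) fun n => weakMeanN_nonneg T n x y
    · filter_upwards [hev x hx, hev y hy, eventually_gt_atTop 0] with n hnx hny hn
      have h1 := weakMeanN_le T n x y (φ m) (K m) (hφK m) D (1 / ((m:ℝ) + 1)) (3 * η) hD hD0
        (hφd m) (by positivity) (by positivity) hn (by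
          intro j hj
          have a1 := abs_lt.1 (hnx j (Finset.mem_range.2 hj))
          have a2 := abs_lt.1 (hny j (Finset.mem_range.2 hj))
          have a3 := abs_lt.1 (hxyG j hj)
          simp only [f] at a1 a2
          linarith [a1.2, a2.1, a3.2])
      have h2 : K m * (3 * η) * D ≤ ε / 4 := by
        calc K m * (3 * η) * D ≤ (K m + 1) * (3 * η) * (D + 1) := by
              gcongr <;> linarith
          _ = ε / 4 := by rw [hη]; field_simp; norm_num
      linarith
  linarith
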